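/- arXiv:2105.10652 — 2 statements merged into one kernel-verified Lean document; each statement's English description precedes it below -/
import Mathlib

section
/- Let a, b, c be real constants with c > 0, b > 0 and b² + 27ac > 0, and set s₊ = (b + √(b² + 24ac))/(4c). Then there exist δ* > 0 and C > 0 such that for every Q ∈ Q₀ with dist(Q, N) < δ*: (1/C)·dist(Q,N)² ≤ F̂_b(Q) ≤ C·dist(Q,N)². -/
noncomputable section

open Matrix

/-- The space of 3×3 real matrices. -/
abbrev Mat3 := Matrix (Fin 3) (Fin 3) ℝ

/-- Frobenius inner product `A : B = ∑ᵢⱼ Aᵢⱼ Bᵢⱼ`. -/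
def frob (A B : Mat3) : ℝ := ∑ i, ∑ j, A i j * B i j

/-- Frobenius norm. -/
def fnorm (A : Mat3) : ℝ := Real.sqrt (frob A A)

/-- The uniaxial matrix `s (d ⊗ d - (1/3) I)`. -/
def uniax (s : ℝ) (d : Fin 3 → ℝ) : Mat3 :=
  s • (vecMulVec d d - (1 / 3 : ℝ) • (1 : Mat3))

/-- The distance (in Frobenius norm) from `Q` to the limit manifold
`N = { s(d⊗d - (1/3)I) : |d| = 1 }`. -/
def distN (s : ℝ) (Q : Mat3) : ℝ :=
  sInf ((fun d : Fin 3 → ℝ => fnorm (Q - uniax s d)) '' {d | ∑ i, d i ^ 2 = 1})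

/-- Landau–de Gennes bulk energy density
`F_b(Q) = -(a/2)|Q|² - (b/3) tr(Q³) + (c/4)|Q|⁴`. -/
def Fb (a b c : ℝ) (Q : Mat3) : ℝ :=
  -(a / 2) * frob Q Q - (b / 3) * (Q * Q * Q).trace + (c / 4) * (frob Q Q) ^ 2

/-- `f_b(s) = -(a/3)s² - (2b/27)s³ + (c/9)s⁴`, the value of `F_b` at the
uniaxial matrix `s(d⊗d - (1/3)I)` for a unit vector `d`. -/
def fbulk (a b c s : ℝ) : ℝ :=
  -(a / 3) * s ^ 2 - (2 * b / 27) * s ^ 3 + (c / 9) * s ^ 4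

/-- The normalized bulk energy `F̂_b(Q) = F_b(Q) - f_b(s₊)`. -/
def hatFb (a b c s : ℝ) (Q : Mat3) : ℝ := Fb a b c Q - fbulk a b c s

/-- The trace-cube of a traceless symmetric matrix in terms of one of its eigenvalues. -/
lemma trace_cube_eq_of_mulVec_eq {Q : Mat3} (hQ : Q.IsSymm) (htr : Q.trace = 0)
    {d : Fin 3 → ℝ} (hd : d ≠ 0) {l : ℝ} (hl : Q *ᵥ d = l • d) :
    (Q * Q * Q).trace = 3 * l ^ 3 - 3 / 2 * frob Q Q * l := by
  have hdet : (Q - l • (1 : Mat3)).det = 0 := by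
    rw [← Matrix.exists_mulVec_eq_zero_iff]
    refine ⟨d, hd, ?_⟩
    rw [Matrix.sub_mulVec, hl, Matrix.smul_mulVec, Matrix.one_mulVec, sub_self]
  have h10 := hQ.apply 0 1
  have h20 := hQ.apply 0 2
  have h21 := hQ.apply 1 2
  simp only [Matrix.trace_fin_three] at htr
  have h22 : Q 2 2 = -Q 0 0 - Q 1 1 := by linarith
  simp [Matrix.det_fin_three, h10, h20, h21, h22] at hdet
  simp only [frob, Matrix.trace_fin_three, Matrix.mul_apply, Fin.sum_univ_three, h10, h20, h21,
    h22]
  linear_combination 3 * hdet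

/-- The squared distance from a traceless matrix to a uniaxial matrix. -/
lemma frob_sub_uniax {Q : Mat3} (htr : Q.trace = 0) (s : ℝ) {d : Fin 3 → ℝ}
    (hd : ∑ i, d i ^ 2 = 1) :
    frob (Q - uniax s d) (Q - uniax s d)
      = frob Q Q - 2 * s * (d ⬝ᵥ Q *ᵥ d) + 2 / 3 * s ^ 2 := by
  simp only [Matrix.trace_fin_three] at htr
  rw [Fin.sum_univ_three] at hd
  have h22 : Q 2 2 = -Q 0 0 - Q 1 1 := by linarith
  simp [frob, uniax, Fin.sum_univ_three, dotProduct, Matrix.mulVec, vecMulVec_apply, h22]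
  linear_combination (s ^ 2 * (d 0 ^ 2 + d 1 ^ 2 + d 2 ^ 2 + 1 / 3)) * hd

lemma frob_self_nonneg (A : Mat3) : 0 ≤ frob A A :=
  Finset.sum_nonneg fun _ _ => Finset.sum_nonneg fun _ _ => mul_self_nonneg _

/-- A real symmetric matrix has a unit eigenvector maximizing its quadratic form on the sphere. -/
lemma exists_top_eigenvector {Q : Mat3} (hQ : Q.IsSymm) :
    ∃ d : Fin 3 → ℝ, ∑ i, d i ^ 2 = 1 ∧ Q *ᵥ d = (d ⬝ᵥ Q *ᵥ d) • d ∧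
      ∀ x : Fin 3 → ℝ, ∑ i, x i ^ 2 = 1 → x ⬝ᵥ Q *ᵥ x ≤ d ⬝ᵥ Q *ᵥ d := by
  have hcomp : IsCompact {d : Fin 3 → ℝ | ∑ i, d i ^ 2 = 1} := by
    refine (isCompact_univ_pi fun _ => isCompact_Icc (a := (-1 : ℝ)) (b := 1)).of_isClosed_subset
      (isClosed_eq (by fun_prop) continuous_const) fun d hd i _ => ?_
    have : d i ^ 2 ≤ 1 := by
      rw [← show ∑ i, d i ^ 2 = 1 from hd]
      exact Finset.single_le_sum (f := fun i => d i ^ 2) (fun _ _ => sq_nonneg _)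
        (Finset.mem_univ i)
    exact abs_le.mp (sq_le_one_iff_abs_le_one _ |>.mp this)
  obtain ⟨d, hd, hmax⟩ := hcomp.exists_isMaxOn ⟨![1, 0, 0], by simp [Fin.sum_univ_three]⟩
    (f := fun d => d ⬝ᵥ Q *ᵥ d) (by fun_prop)
  replace hd : ∑ i, d i ^ 2 = 1 := hd
  set l := d ⬝ᵥ Q *ᵥ d with hl
  have hle : ∀ x : Fin 3 → ℝ, ∑ i, x i ^ 2 = 1 → x ⬝ᵥ Q *ᵥ x ≤ l := fun x hx => hmax hx
  refine ⟨d, hd, ?_, hle⟩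
  have hself : ∀ x : Fin 3 → ℝ, x ⬝ᵥ x = ∑ i, x i ^ 2 := fun x => by simp [dotProduct, sq]
  have hform : ∀ x : Fin 3 → ℝ,
      x ⬝ᵥ (l • (1 : Mat3) - Q) *ᵥ x = l * ∑ i, x i ^ 2 - x ⬝ᵥ Q *ᵥ x := fun x => by
    rw [Matrix.sub_mulVec, Matrix.smul_mulVec, Matrix.one_mulVec, dotProduct_sub,
      dotProduct_smul, hself, smul_eq_mul]
  have hpsd : (l • (1 : Mat3) - Q).PosSemidef := by
    refine Matrix.PosSemidef.of_dotProduct_mulVec_nonneg ?_ fun x => ?_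
    · change (l • (1 : Mat3) - Q)ᵀ = _
      rw [Matrix.transpose_sub, Matrix.transpose_smul, Matrix.transpose_one, hQ.eq]
    · rw [star_trivial, hform]
      rcases (Finset.sum_nonneg fun i _ => sq_nonneg (x i)).eq_or_lt' with h0 | hpos
      · have : x = 0 := by
          rw [← hself] at h0
          exact dotProduct_self_eq_zero.mp h0
        simp [this]
      · set n := ∑ i, x i ^ 2 with hn
        have hr : Real.sqrt n ^ 2 = n := Real.sq_sqrt hpos.le
        have := hle ((Real.sqrt n)⁻¹ • x) (by
          simp only [Pi.smul_apply, smul_eq_mul, mul_pow, ← Finset.mul_sum, ← hn, inv_pow, hr]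
          exact inv_mul_cancel₀ hpos.ne')
        rw [Matrix.mulVec_smul, dotProduct_smul, smul_dotProduct, smul_eq_mul, smul_eq_mul,
          ← mul_assoc, ← mul_inv, ← sq, hr, inv_mul_le_iff₀ hpos] at this
        linarith
  have hzero := (hpsd.dotProduct_mulVec_zero_iff d).mp (by
    rw [star_trivial, hform, hd, mul_one, ← hl, sub_self])
  rw [Matrix.sub_mulVec, Matrix.smul_mulVec, Matrix.one_mulVec, sub_eq_zero] at hzero
  exact hzero.symm

/-- The distance to the limit manifold is attained at a maximizer of the quadratic form. -/
lemma distN_sq_eq {Q : Mat3} (htr : Q.trace = 0) {s : ℝ} (hs : 0 ≤ s) {d : Fin 3 → ℝ}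
    (hd : ∑ i, d i ^ 2 = 1)
    (hmax : ∀ x : Fin 3 → ℝ, ∑ i, x i ^ 2 = 1 → x ⬝ᵥ Q *ᵥ x ≤ d ⬝ᵥ Q *ᵥ d) :
    distN s Q ^ 2 = frob Q Q - 2 * s * (d ⬝ᵥ Q *ᵥ d) + 2 / 3 * s ^ 2 := by
  have : distN s Q = fnorm (Q - uniax s d) := by
    refine IsLeast.csInf_eq ⟨⟨d, hd, rfl⟩, ?_⟩
    rintro _ ⟨x, hx, rfl⟩
    refine Real.sqrt_le_sqrt ?_
    rw [frob_sub_uniax htr s hd, frob_sub_uniax htr s hx]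
    have := mul_le_mul_of_nonneg_left (hmax x hx) hs
    linarith
  rw [this, fnorm, Real.sq_sqrt (frob_self_nonneg _), frob_sub_uniax htr s hd]

lemma distN_nonneg (s : ℝ) (Q : Mat3) : 0 ≤ distN s Q := by
  refine Real.sInf_nonneg ?_
  rintro _ ⟨x, -, rfl⟩
  exact Real.sqrt_nonneg _

/-- In terms of `x = t - s` and `w ≥ 0`, a traceless symmetric matrix with top eigenvalue `2t/3`
satisfies `dist² = 2x²/3 + 2w`, and its bulk energy splits accordingly. -/
lemma exists_distN_sq_hatFb_eq {a b c s : ℝ} (hs : 0 ≤ s) (ha : 3 * a = 2 * c * s ^ 2 - b * s)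
    {Q : Mat3} (hQ : Q.IsSymm) (htr : Q.trace = 0) :
    ∃ x w : ℝ, 0 ≤ w ∧ distN s Q ^ 2 = 2 / 3 * x ^ 2 + 2 * w ∧
      hatFb a b c s Q =
        x ^ 2 / 9 * (c * (x + s) ^ 2 + (2 * c * s - 2 * b / 3) * (x + s) + (c * s ^ 2 - b * s / 3))
        + w * (b * s + 2 / 3 * (b + 2 * c * s) * x + 2 * c / 3 * x ^ 2) + c * w ^ 2 := by
  obtain ⟨d, hd, heig, hmax⟩ := exists_top_eigenvector hQ
  have hdist := distN_sq_eq htr hs hd hmax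
  set l := d ⬝ᵥ Q *ᵥ d with hl
  have hd0 : d ≠ 0 := by
    rintro rfl
    simp at hd
  have hcube := trace_cube_eq_of_mulVec_eq hQ htr hd0 heig
  have hw := frob_self_nonneg (Q - uniax (3 / 2 * l) d)
  rw [frob_sub_uniax htr _ hd, ← hl] at hw
  refine ⟨3 / 2 * l - s, (frob Q Q - 3 / 2 * l ^ 2) / 2, by linarith, ?_, ?_⟩
  · rw [hdist]
    ring
  · obtain rfl : a = (2 * c * s ^ 2 - b * s) / 3 := by linarith
    rw [hatFb, Fb, fbulk, hcube]
    ring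

/-- for `c > 0`, `b > 0`, `b² + 27ac > 0` and
`s₊ = (b + √(b²+24ac))/(4c)`, there exist `δ* > 0` and `C > 0` such that
`(1/C)·dist(Q,N)² ≤ F̂_b(Q) ≤ C·dist(Q,N)²` whenever `Q ∈ Q₀` and
`dist(Q,N) < δ*`. -/
theorem stmt8 (a b c : ℝ) (hc : 0 < c) (hb : 0 < b) (h : 0 < b ^ 2 + 27 * a * c)
    (s : ℝ) (hs : s = (b + Real.sqrt (b ^ 2 + 24 * a * c)) / (4 * c)) :
    ∃ δ : ℝ, 0 < δ ∧ ∃ C : ℝ, 0 < C ∧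
      ∀ Q : Mat3, Q.IsSymm → Q.trace = 0 → distN s Q < δ →
        (1 / C) * (distN s Q) ^ 2 ≤ hatFb a b c s Q ∧
          hatFb a b c s Q ≤ C * (distN s Q) ^ 2 := by
  have hroot : b / 3 < Real.sqrt (b ^ 2 + 24 * a * c) :=
    Real.lt_sqrt_of_sq_lt (by nlinarith)
  have hsq : Real.sqrt (b ^ 2 + 24 * a * c) ^ 2 = b ^ 2 + 24 * a * c :=
    Real.sq_sqrt (by nlinarith)
  have hr : Real.sqrt (b ^ 2 + 24 * a * c) = 4 * c * s - b := by
    rw [hs]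
    field_simp
    ring
  rw [hr] at hroot hsq
  have hcs : b < 3 * (c * s) := by linarith
  have hs0 : 0 < s := pos_of_mul_pos_right (by linarith : 0 < c * s) hc.le
  have ha : 3 * a = 2 * c * s ^ 2 - b * s :=
    mul_left_cancel₀ hc.ne' (by linear_combination -hsq / 8)
  have hbs : 0 < b * s := mul_pos hb hs0
  have hcs2 : 0 < c * s ^ 2 := by positivity
  set k := b / 3 * (s - b / (3 * c)) with hk
  have hk0 : 0 < k := by
    refine mul_pos (by positivity) (sub_pos.mpr ?_)
    rw [div_lt_iff₀ (by positivity)]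
    linarith
  obtain ⟨m, hm0, hmk, hmb⟩ : ∃ m : ℝ, 0 < m ∧ m ≤ k / 9 ∧ m ≤ b * s / 2 :=
    ⟨min (k / 9) (b * s / 2), lt_min (by positivity) (by positivity), min_le_left _ _,
      min_le_right _ _⟩
  set M := 2 * (b * s) + 4 * (c * s ^ 2) with hM
  have hM0 : 0 < M := by positivity
  have hden : 0 < b + 2 * c * s := by positivity
  refine ⟨b * s / (4 * (b + 2 * c * s)), by positivity, 2 / m + 3 / 2 * M, by positivity,
    fun Q hQ htr hlt => ?_⟩
  obtain ⟨x, w, hw, hD, hF⟩ := exists_distN_sq_hatFb_eq hs0.le ha hQ htr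
  set δ := b * s / (4 * (b + 2 * c * s)) with hδ
  have hδ0 : 0 < δ := by positivity
  have hδb : δ * (b + 2 * c * s) = b * s / 4 := by
    rw [hδ]
    field_simp
  have hδs : δ ≤ s / 4 := by
    rw [hδ, div_le_iff₀ (by positivity)]
    linarith
  have hDδ : distN s Q ^ 2 ≤ δ ^ 2 := pow_le_pow_left₀ (distN_nonneg s Q) hlt.le 2
  have hxabs : |x| ≤ 3 / 2 * δ := abs_le_of_sq_le_sq (by linarith [sq_nonneg δ]) (by positivity)
  obtain ⟨hx1, hx2⟩ := abs_le.mp hxabs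
  have hws : w ≤ s ^ 2 := by linarith [pow_le_pow_left₀ hδ0.le hδs 2, sq_nonneg x, sq_nonneg s]
  have hPx : |(b + 2 * c * s) * x| ≤ 3 / 8 * (b * s) := by
    rw [abs_mul, abs_of_pos hden]
    linarith [mul_le_mul_of_nonneg_left hxabs hden.le]
  obtain ⟨hP1, hP2⟩ := abs_le.mp hPx
  have hxx : x ^ 2 ≤ s ^ 2 := sq_le_sq' (by linarith) (by linarith)
  have hcx : c * x ^ 2 ≤ c * s ^ 2 := mul_le_mul_of_nonneg_left hxx hc.le
  have hcx0 : 0 ≤ c * x ^ 2 := by positivity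
  set B := c * (x + s) ^ 2 + (2 * c * s - 2 * b / 3) * (x + s) + (c * s ^ 2 - b * s / 3) with hB
  have hBk : B = k + c * (x + 2 * s - b / (3 * c)) ^ 2 := by
    rw [hB, hk]
    field_simp
    ring
  have hBlow : k ≤ B := by
    rw [hBk]
    exact le_add_of_nonneg_right (by positivity)
  have hBup : B ≤ 9 * (c * s ^ 2) := by
    have h1 : 0 ≤ x + s := by linarith
    have h2 : (x + 2 * s) ^ 2 ≤ (3 * s) ^ 2 := pow_le_pow_left₀ (by linarith) (by linarith) 2
    have h3 := mul_le_mul_of_nonneg_left h2 hc.le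
    linarith [mul_nonneg hb.le h1]
  have hlow : m * (x ^ 2 + w) ≤ hatFb a b c s Q := by
    have h1 : x ^ 2 * m ≤ x ^ 2 * (B / 9) := mul_le_mul_of_nonneg_left (by linarith) (sq_nonneg x)
    have h2 : w * m ≤ w * (b * s + 2 / 3 * (b + 2 * c * s) * x + 2 * c / 3 * x ^ 2) :=
      mul_le_mul_of_nonneg_left (by linarith) hw
    have h3 : 0 ≤ c * w ^ 2 := by positivity
    rw [hF]
    linarith
  have hup : hatFb a b c s Q ≤ M * (x ^ 2 + w) := by
    have h1 : x ^ 2 * (B / 9) ≤ x ^ 2 * M := mul_le_mul_of_nonneg_left (by linarith) (sq_nonneg x)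
    have hcw : c * w ≤ c * s ^ 2 := mul_le_mul_of_nonneg_left hws hc.le
    have h2 : w * (b * s + 2 / 3 * (b + 2 * c * s) * x + 2 * c / 3 * x ^ 2 + c * w) ≤ w * M :=
      mul_le_mul_of_nonneg_left (by linarith) hw
    rw [hF]
    linarith
  have hxw : 0 ≤ x ^ 2 + w := by positivity
  constructor
  · rw [one_div, inv_mul_le_iff₀ (by positivity)]
    have h1 : 2 / m * (m * (x ^ 2 + w)) = 2 * (x ^ 2 + w) := by field_simp
    have h2 : 2 / m * (m * (x ^ 2 + w)) ≤ 2 / m * hatFb a b c s Q :=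
      mul_le_mul_of_nonneg_left hlow (by positivity)
    have h3 : 0 ≤ hatFb a b c s Q := le_trans (by positivity) hlow
    have h4 : 0 ≤ 3 / 2 * M * hatFb a b c s Q := by positivity
    rw [hD]
    linarith [sq_nonneg x]
  · have h1 : 0 ≤ 2 / m * distN s Q ^ 2 := by positivity
    have h2 : 0 ≤ M * w := by positivity
    rw [hD] at h1 ⊢
    linarith
end
end

section
/- Let U ⊂ ℝ² be open, let λ₁, λ₂, λ₃ : U → ℝ and d₁, d₂, d₃ : U → ℝ³ be differentiable, with d₁(y), d₂(y), d₃(y) an orthonormal basis of ℝ³ for every y ∈ U and λ₁ + λ₂ + λ₃ = 0 pointwise. Define Q = λ₁ d₁⊗d₁ + λ₂ d₂⊗d₂ + λ₃ d₃⊗d₃ and, for i ≠ j, D_{ij} = Σ_{k=1}^{2}(d_i · ∂_k d_j)². Then at every point of U: Σ_{k=1}^{2}|∂_k Q|² = Σ_{i=1}^{3}|∇λ_i|² + 2λ₁²|∇d₁|² + 2λ₂²|∇d₂|² + 2λ₃²|∇d₃|² - 4λ₁λ₂ D₁₂ - 4λ₁λ₃ D₁₃ - 4λ₂λ₃ D₂₃,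 where |∂_k Q| is the Frobenius norm, |∇λ_i|² = Σ_{k=1}^{2}(∂_k λ_i)² and |∇d_i|² = Σ_{k=1}^{2}|∂_k d_i|². -/
noncomputable section

/-- Partial derivative in the `k`-th coordinate direction of `ℝ²`. -/
def pd {E : Type*} [NormedAddCommGroup E] [NormedSpace ℝ E]
    (k : Fin 2) (f : (Fin 2 → ℝ) → E) (x : Fin 2 → ℝ) : E :=
  fderiv ℝ f x (Pi.single k 1)

/-- Frobenius inner product of 3×3 arrays. -/
def frobP (A B : Fin 3 → Fin 3 → ℝ) : ℝ := ∑ i, ∑ j, A i j * B i j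

/-- Frobenius inner product of two first variations of rank-one matrices `a u⊗u` and `b v⊗v`. -/
lemma frobenius_variation_rank_one (a a' b b' : ℝ) (u u' v v' : Fin 3 → ℝ) :
    ∑ i, ∑ j, (a * (u i * u' j + u' i * u j) + a' * (u i * u j)) *
        (b * (v i * v' j + v' i * v j) + b' * (v i * v j)) =
      2 * a * b * ((∑ m, u m * v m) * (∑ m, u' m * v' m) +
          (∑ m, u m * v' m) * (∑ m, v m * u' m)) +
        2 * a * b' * ((∑ m, u m * v m) * (∑ m, v m * u' m)) +
        2 * a' * b * ((∑ m, u m * v m) * (∑ m, u m * v' m)) +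
        a' * b' * (∑ m, u m * v m) ^ 2 := by
  simp only [Fin.sum_univ_three]
  ring

/-- Squared Frobenius norm of the variation of `∑ₘ aₘ dₘ⊗dₘ` along an orthonormal frame. -/
lemma frobenius_sq_variation_orthonormal (a a' : Fin 3 → ℝ) (d d' : Fin 3 → Fin 3 → ℝ)
    (h : ∀ i j, ∑ m, d i m * d j m = if i = j then 1 else 0)
    (h' : ∀ i j, (∑ m, d i m * d' j m) = -∑ m, d j m * d' i m) :
    frobP
        (fun i j => ∑ m, (a m * (d m i * d' m j + d' m i * d m j) + a' m * (d m i * d m j)))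
        (fun i j => ∑ m, (a m * (d m i * d' m j + d' m i * d m j) + a' m * (d m i * d m j))) =
      (∑ m, a' m ^ 2) + 2 * a 0 ^ 2 * (∑ m, d' 0 m ^ 2) + 2 * a 1 ^ 2 * (∑ m, d' 1 m ^ 2) +
        2 * a 2 ^ 2 * (∑ m, d' 2 m ^ 2) -
        4 * a 0 * a 1 * (∑ m, d 0 m * d' 1 m) ^ 2 -
        4 * a 0 * a 2 * (∑ m, d 0 m * d' 2 m) ^ 2 -
        4 * a 1 * a 2 * (∑ m, d 1 m * d' 2 m) ^ 2 := by
  have hself : ∀ i, ∑ m, d i m * d' i m = 0 := fun i => by linarith [h' i i]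
  have hexpand : ∀ P : Fin 3 → Fin 3 → Fin 3 → ℝ,
      frobP (fun i j => ∑ m, P m i j) (fun i j => ∑ m, P m i j) =
        ∑ m, ∑ n, ∑ i, ∑ j, P m i j * P n i j := fun P => by
    simp only [frobP, Fin.sum_univ_three]
    ring
  rw [hexpand]
  simp only [frobenius_variation_rank_one, h]
  rw [Fin.sum_univ_three, Fin.sum_univ_three fun m => a' m ^ 2]
  simp only [Fin.sum_univ_three (fun n : Fin 3 => (_ : ℝ) + _ * (ite _ _ _) ^ 2), hself,
    h' 1 0, h' 2 0, h' 2 1, ← pow_two]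
  simp
  ring

/-- Partial derivatives commute with taking coordinates. -/
lemma pd_apply {ι : Type*} [Fintype ι] {E : ι → Type*} [∀ i, NormedAddCommGroup (E i)]
    [∀ i, NormedSpace ℝ (E i)] {f : (Fin 2 → ℝ) → ∀ i, E i} {x : Fin 2 → ℝ}
    (hf : DifferentiableAt ℝ f x) (k : Fin 2) (i : ι) :
    pd k f x i = pd k (fun y => f y i) x := by
  simp only [pd]
  rw [fderiv_apply hf]
  rfl

lemma pd_mul {f g : (Fin 2 → ℝ) → ℝ} {x : Fin 2 → ℝ} (hf : DifferentiableAt ℝ f x)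
    (hg : DifferentiableAt ℝ g x) (k : Fin 2) :
    pd k (fun y => f y * g y) x = f x * pd k g x + g x * pd k f x := by
  simp only [pd]
  rw [fderiv_fun_mul hf hg]
  simp

lemma pd_sum {ι : Type*} [Fintype ι] {f : ι → (Fin 2 → ℝ) → ℝ} {x : Fin 2 → ℝ}
    (hf : ∀ i, DifferentiableAt ℝ (f i) x) (k : Fin 2) :
    pd k (fun y => ∑ i, f i y) x = ∑ i, pd k (f i) x := by
  simp only [pd]
  rw [fderiv_fun_sum fun i _ => hf i]
  simp

/-- if `λ₁,λ₂,λ₃ : U → ℝ` and `d₁,d₂,d₃ : U → ℝ³` are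
differentiable on the open `U ⊆ ℝ²`, pointwise orthonormal and with
`λ₁+λ₂+λ₃ = 0`, and `Q = ∑ᵢ λᵢ dᵢ⊗dᵢ`, then at every point of `U`:
`|∇Q|² = ∑ᵢ|∇λᵢ|² + 2λ₁²|∇d₁|² + 2λ₂²|∇d₂|² + 2λ₃²|∇d₃|²
  - 4λ₁λ₂D₁₂ - 4λ₁λ₃D₁₃ - 4λ₂λ₃D₂₃`,
where `D_{ij} = ∑ₖ (dᵢ·∂ₖdⱼ)²`. -/
theorem stmt18 (U : Set (Fin 2 → ℝ)) (hU : IsOpen U)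
    (lam : Fin 3 → (Fin 2 → ℝ) → ℝ)
    (dv : Fin 3 → (Fin 2 → ℝ) → (Fin 3 → ℝ))
    (hlam : ∀ m : Fin 3, ∀ y ∈ U, DifferentiableAt ℝ (lam m) y)
    (hdv : ∀ m : Fin 3, ∀ y ∈ U, DifferentiableAt ℝ (dv m) y)
    (horth : ∀ y ∈ U, ∀ i j : Fin 3,
      ∑ m, dv i y m * dv j y m = if i = j then 1 else 0)
    (hsum : ∀ y ∈ U, lam 0 y + lam 1 y + lam 2 y = 0) :
    let Q : (Fin 2 → ℝ) → (Fin 3 → Fin 3 → ℝ) :=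
      fun y i j => ∑ m, lam m y * (dv m y i * dv m y j)
    ∀ x ∈ U,
      let Dij : Fin 3 → Fin 3 → ℝ :=
        fun i j => ∑ k : Fin 2, (∑ m, dv i x m * pd k (dv j) x m) ^ 2
      ∑ k : Fin 2, frobP (pd k Q x) (pd k Q x) =
        (∑ m : Fin 3, ∑ k : Fin 2, (pd k (lam m) x) ^ 2) +
          2 * (lam 0 x) ^ 2 * (∑ k : Fin 2, ∑ m, (pd k (dv 0) x m) ^ 2) +
          2 * (lam 1 x) ^ 2 * (∑ k : Fin 2, ∑ m, (pd k (dv 1) x m) ^ 2) +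
          2 * (lam 2 x) ^ 2 * (∑ k : Fin 2, ∑ m, (pd k (dv 2) x m) ^ 2) -
          4 * lam 0 x * lam 1 x * Dij 0 1 -
          4 * lam 0 x * lam 2 x * Dij 0 2 -
          4 * lam 1 x * lam 2 x * Dij 1 2 := by
  intro Q x hx Dij
  have hd : ∀ m i, DifferentiableAt ℝ (fun y => dv m y i) x := fun m i =>
    differentiableAt_pi.1 (hdv m x hx) i
  have hl : ∀ m, DifferentiableAt ℝ (lam m) x := fun m => hlam m x hx
  have hskew : ∀ (k : Fin 2) (i j : Fin 3),
      (∑ m, dv i x m * pd k (dv j) x m) = -∑ m, dv j x m * pd k (dv i) x m := fun k i j => by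
    have hconst : pd k (fun y => ∑ m, dv i y m * dv j y m) x = 0 := by
      have heq : (fun y => ∑ m, dv i y m * dv j y m) =ᶠ[nhds x]
          fun _ => if i = j then (1 : ℝ) else 0 := by
        filter_upwards [hU.mem_nhds hx] with y hy using horth y hy i j
      simp [pd, heq.fderiv_eq]
    rw [pd_sum fun m => (hd i m).fun_mul (hd j m)] at hconst
    simp only [pd_mul (hd _ _) (hd _ _), Finset.sum_add_distrib] at hconst
    simp only [pd_apply (hdv _ x hx)]
    linarith
  have hQ : ∀ k, pd k Q x = fun i j => ∑ m,
      (lam m x * (dv m x i * pd k (dv m) x j + pd k (dv m) x i * dv m x j) +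
        pd k (lam m) x * (dv m x i * dv m x j)) := fun k => by
    have hterm : ∀ i j m, DifferentiableAt ℝ (fun y => lam m y * (dv m y i * dv m y j)) x :=
      fun i j m => (hl m).fun_mul ((hd m i).fun_mul (hd m j))
    have hQrow : ∀ i, DifferentiableAt ℝ (fun y => Q y i) x := fun i =>
      differentiableAt_pi.2 fun j => DifferentiableAt.fun_sum fun m _ => hterm i j m
    ext i j
    rw [pd_apply (differentiableAt_pi.2 hQrow), pd_apply (hQrow i), pd_sum (hterm i j)]
    refine Finset.sum_congr rfl fun m _ => ?_
    rw [pd_mul (hl m) ((hd m i).fun_mul (hd m j)), pd_mul (hd m i) (hd m j),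
      pd_apply (hdv m x hx), pd_apply (hdv m x hx)]
    ring
  have key := fun k => frobenius_sq_variation_orthonormal (fun m => lam m x)
    (fun m => pd k (lam m) x) (fun m => dv m x) (fun m => pd k (dv m) x) (horth x hx) (hskew k)
  simp only [hQ, key]
  simp only [Dij, Fin.sum_univ_two, Finset.sum_add_distrib]
  ring
end
end
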